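/- For every ξ > 0 and every u ∈ C_c^∞(ℂⁿ), one has ∫_{ℂⁿ} |(1 − B_ξ)u|² e^{−2ξ|z|²} dA(z) ≤ (2/ξ) ∫_{ℂⁿ} ( Σ_{j=1}^n |∂_{z̄_j} u|² ) e^{−2ξ|z|²} dA(z), where B_ξ denotes the orthogonal projection of L²(ℂⁿ, e^{−2ξ|z|²} dA) onto the Fock space F_ξ. -/

import Mathlib

open MeasureTheory Complex Filter
open scoped ContDiff ENNReal

noncomputable section

abbrev Hgrp (n : ℕ) := (Fin n → ℂ) × ℝ

def nsq {n : ℕ} (z : Fin n → ℂ) : ℝ := ∑ j, Complex.normSq (z j)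

def dZ {n : ℕ} (j : Fin n) (f : Hgrp n → ℂ) : Hgrp n → ℂ := fun p =>
  (1/2 : ℂ) * (fderiv ℝ f p (Pi.single j 1, 0) - Complex.I * fderiv ℝ f p (Pi.single j Complex.I, 0))

def dZbar {n : ℕ} (j : Fin n) (f : Hgrp n → ℂ) : Hgrp n → ℂ := fun p =>
  (1/2 : ℂ) * (fderiv ℝ f p (Pi.single j 1, 0) + Complex.I * fderiv ℝ f p (Pi.single j Complex.I, 0))

def dT {n : ℕ} (f : Hgrp n → ℂ) : Hgrp n → ℂ := fun p => fderiv ℝ f p (0, 1)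

def Lop {n : ℕ} (j : Fin n) (f : Hgrp n → ℂ) : Hgrp n → ℂ := fun p =>
  dZ j f p + Complex.I * (starRingEnd ℂ) (p.1 j) * dT f p

def Lbar {n : ℕ} (j : Fin n) (f : Hgrp n → ℂ) : Hgrp n → ℂ := fun p =>
  dZbar j f p - Complex.I * (p.1 j) * dT f p

/-- `f` is CR in the sense of distributions. -/
def IsCRfun {n : ℕ} (f : Hgrp n → ℂ) : Prop :=
  ∀ j : Fin n, ∀ φ : Hgrp n → ℂ, ContDiff ℝ ∞ φ → HasCompactSupport φ →
    ∫ p : Hgrp n, f p * Lbar j φ p = 0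

def pFourier {n : ℕ} (f : Hgrp n → ℂ) (z : Fin n → ℂ) (ξ : ℝ) : ℂ :=
  (Real.sqrt (2 * Real.pi))⁻¹ • ∫ t : ℝ, f (z, t) * Complex.exp (-Complex.I * ξ * t)

/-- The Gaussian measure e^{−2ξ|z|²} dA on ℂⁿ. -/
def gaussMeasure (n : ℕ) (ξ : ℝ) : Measure (Fin n → ℂ) :=
  volume.withDensity fun z => ENNReal.ofReal (Real.exp (-2 * ξ * nsq z))

/-- The Fock space: elements of L²(ℂⁿ, e^{−2ξ|z|²}dA) agreeing a.e. with an entire function. -/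
def FockSet (n : ℕ) (ξ : ℝ) : Set (Lp ℂ 2 (gaussMeasure n ξ)) :=
  {f | ∃ g : (Fin n → ℂ) → ℂ, Differentiable ℂ g ∧ (⇑f : (Fin n → ℂ) → ℂ) =ᵐ[gaussMeasure n ξ] g}

/-- The Wirtinger derivative ∂/∂z̄ⱼ acting on functions of z ∈ ℂⁿ. -/
def dZbarC {n : ℕ} (j : Fin n) (g : (Fin n → ℂ) → ℂ) : (Fin n → ℂ) → ℂ := fun z =>
  (1/2 : ℂ) * (fderiv ℝ g z (Pi.single j 1) + Complex.I * fderiv ℝ g z (Pi.single j Complex.I))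

open MvPolynomial in
/-- Formal adjoint `-∂_{zⱼ} + 2ξ z̄ⱼ` of `∂_{z̄ⱼ}` for the Gaussian weight; the variables `inl j` and
`inr j` stand for `zⱼ` and `z̄ⱼ`. -/
def polyAdj {n : ℕ} (ξ : ℝ) (j : Fin n) :
    MvPolynomial (Fin n ⊕ Fin n) ℂ →ₗ[ℂ] MvPolynomial (Fin n ⊕ Fin n) ℂ :=
  -(pderiv (Sum.inl j)).toLinearMap + (2 * ξ : ℂ) • LinearMap.mulLeft ℂ (X (Sum.inr j))

open MvPolynomial in
/-- The operator `∑ⱼ (∂_{z̄ⱼ})^* ∂_{z̄ⱼ}` on polynomials in `z` and `z̄`. -/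
def polyLaplacian {n : ℕ} (ξ : ℝ) :
    MvPolynomial (Fin n ⊕ Fin n) ℂ →ₗ[ℂ] MvPolynomial (Fin n ⊕ Fin n) ℂ :=
  ∑ j, polyAdj ξ j ∘ₗ (pderiv (Sum.inr j)).toLinearMap

section Algebra

open MvPolynomial

variable {n : ℕ}

lemma pderiv_comm {σ R : Type*} [CommRing R] (i j : σ) (p : MvPolynomial σ R) :
    pderiv i (pderiv j p) = pderiv j (pderiv i p) := by
  classical
  have h : ⁅pderiv (R := R) i, pderiv (R := R) j⁆ = 0 := by
    apply MvPolynomial.derivation_ext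
    intro k
    rw [Derivation.commutator_apply, pderiv_X, pderiv_X]
    by_cases h1 : j = k <;> by_cases h2 : i = k <;> simp [h1, h2]
  have := congrArg (fun D => D p) h
  simpa [Derivation.commutator_apply, sub_eq_zero] using this

lemma polyAdj_apply (ξ : ℝ) (j : Fin n) (p : MvPolynomial (Fin n ⊕ Fin n) ℂ) :
    polyAdj ξ j p = -pderiv (Sum.inl j) p + (2 * ξ : ℂ) • (X (Sum.inr j) * p) := rfl

lemma polyLaplacian_apply (ξ : ℝ) (p : MvPolynomial (Fin n ⊕ Fin n) ℂ) :
    polyLaplacian ξ p = ∑ j, polyAdj ξ j (pderiv (Sum.inr j) p) := by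
  simp [polyLaplacian]

lemma pderiv_polyAdj (ξ : ℝ) (j k : Fin n) (p : MvPolynomial (Fin n ⊕ Fin n) ℂ) :
    pderiv (Sum.inr k) (polyAdj ξ j p) =
      polyAdj ξ j (pderiv (Sum.inr k) p) + if j = k then (2 * ξ : ℂ) • p else 0 := by
  classical
  simp only [polyAdj_apply, map_add, map_neg, Derivation.map_smul, Derivation.leibniz, pderiv_X,
    smul_eq_mul]
  rw [pderiv_comm (Sum.inr k)]
  by_cases h : j = k
  · subst h
    simp only [Pi.single_eq_same, mul_one, smul_add, if_true]
    ring
  · simp [h]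

lemma polyLaplacian_mul (ξ : ℝ) (d : ℕ) (q m : MvPolynomial (Fin n) ℂ) (hm : m.IsHomogeneous d) :
    polyLaplacian ξ (rename Sum.inl q * rename Sum.inr m) =
      (2 * ξ * d : ℂ) • (rename Sum.inl q * rename Sum.inr m) -
        ∑ j, rename Sum.inl (pderiv j q) * rename Sum.inr (pderiv j m) := by
  have hl (j : Fin n) (r : MvPolynomial (Fin n) ℂ) :
      pderiv (Sum.inl j : Fin n ⊕ Fin n) (rename Sum.inr r) = 0 := by
    apply pderiv_eq_zero_of_notMem_vars
    intro h
    simpa using vars_rename _ _ h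
  have hr (j : Fin n) (r : MvPolynomial (Fin n) ℂ) :
      pderiv (Sum.inr j : Fin n ⊕ Fin n) (rename Sum.inl r) = 0 := by
    apply pderiv_eq_zero_of_notMem_vars
    intro h
    simpa using vars_rename _ _ h
  have key : (d : ℂ) • (rename Sum.inr m : MvPolynomial (Fin n ⊕ Fin n) ℂ) =
      ∑ j, X (Sum.inr j) * rename Sum.inr (pderiv j m) := by
    have := congrArg (rename (Sum.inr : Fin n → Fin n ⊕ Fin n)) hm.sum_X_mul_pderiv
    simp only [map_sum, map_mul, rename_X, map_nsmul] at this
    rw [this, Nat.cast_smul_eq_nsmul]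
  rw [polyLaplacian_apply, mul_smul, ← mul_smul_comm (d : ℂ), key, Finset.mul_sum, Finset.smul_sum,
    ← Finset.sum_sub_distrib]
  refine Finset.sum_congr rfl fun j _ => ?_
  simp only [polyAdj_apply, Derivation.leibniz, smul_eq_mul, hr, hl, mul_zero, add_zero, zero_add,
    pderiv_rename Sum.inl_injective, pderiv_rename Sum.inr_injective]
  rw [mul_left_comm (X _)]
  ring

/-- Every polynomial is the sum of a holomorphic one and one in the range of `polyLaplacian`. -/
lemma exists_eq_rename_add_polyLaplacian {ξ : ℝ} (hξ : 0 < ξ)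
    (p : MvPolynomial (Fin n ⊕ Fin n) ℂ) :
    ∃ (q : MvPolynomial (Fin n) ℂ) (ψ : MvPolynomial (Fin n ⊕ Fin n) ℂ),
      p = rename Sum.inl q + polyLaplacian ξ ψ := by
  let W : Submodule ℂ (MvPolynomial (Fin n ⊕ Fin n) ℂ) :=
    LinearMap.range (rename (Sum.inl : Fin n → Fin n ⊕ Fin n)).toLinearMap ⊔
      LinearMap.range (polyLaplacian ξ)
  have hprod (d : ℕ) : ∀ q m : MvPolynomial (Fin n) ℂ, m.IsHomogeneous d →
      rename Sum.inl q * rename Sum.inr m ∈ W := by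
    induction d with
    | zero =>
      intro q m hm
      rw [← totalDegree_zero_iff_isHomogeneous, totalDegree_eq_zero_iff_eq_C] at hm
      refine Submodule.mem_sup_left ⟨q * C (coeff 0 m), ?_⟩
      rw [hm]
      simp
    | succ d ih =>
      intro q m hm
      have hsum : ∑ j, rename Sum.inl (pderiv j q) * rename Sum.inr (pderiv j m) ∈ W :=
        Submodule.sum_mem _ fun j _ => ih _ _ hm.pderiv
      have hL : polyLaplacian ξ (rename Sum.inl q * rename Sum.inr m) ∈ W :=
        Submodule.mem_sup_right ⟨_, rfl⟩
      have h := W.add_mem hL hsum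
      rw [polyLaplacian_mul ξ _ q m hm, sub_add_cancel] at h
      refine (W.smul_mem_iff ?_).1 h
      exact mul_ne_zero (mul_ne_zero two_ne_zero (by exact_mod_cast hξ.ne'))
        (by exact_mod_cast d.succ_ne_zero)
  have hmem : p ∈ W := by
    induction p using MvPolynomial.induction_on' with
    | add p q hp hq => exact W.add_mem hp hq
    | monomial s a =>
      have hs : s = (s.comapDomain Sum.inl Sum.inl_injective.injOn).mapDomain Sum.inl +
          (s.comapDomain Sum.inr Sum.inr_injective.injOn).mapDomain Sum.inr := by
        ext (i | i)
        · simp [Finsupp.mapDomain_apply Sum.inl_injective, Finsupp.mapDomain_of_notMem_range]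
        · simp [Finsupp.mapDomain_apply Sum.inr_injective, Finsupp.mapDomain_of_notMem_range]
      have h := hprod _ (monomial (s.comapDomain Sum.inl Sum.inl_injective.injOn) a)
        (monomial (s.comapDomain Sum.inr Sum.inr_injective.injOn) 1) (isHomogeneous_monomial 1 rfl)
      rwa [rename_monomial, rename_monomial, monomial_mul, mul_one, ← hs] at h
  obtain ⟨a, ⟨q, rfl⟩, b, ⟨ψ, rfl⟩, h⟩ := Submodule.mem_sup.1 hmem
  exact ⟨q, ψ, h.symm⟩

end Algebra

section Hilbert

open MvPolynomial

variable {n : ℕ} {H : Type*} [NormedAddCommGroup H] [InnerProductSpace ℂ H]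

/-- The basic estimate `∑ⱼ ‖∂_{z̄ⱼ} p‖² ≤ (2ξ)⁻¹ ‖∑ⱼ (∂_{z̄ⱼ})^* ∂_{z̄ⱼ} p‖²`. -/
lemma sum_norm_pderiv_sq_le (ξ : ℝ) (ι : MvPolynomial (Fin n ⊕ Fin n) ℂ →ₗ[ℂ] H)
    (hadj : ∀ j p q, inner ℂ (ι (polyAdj ξ j p)) (ι q) =
      inner ℂ (ι p) (ι (pderiv (Sum.inr j) q)))
    (p : MvPolynomial (Fin n ⊕ Fin n) ℂ) :
    2 * ξ * ∑ j, ‖ι (pderiv (Sum.inr j) p)‖ ^ 2 ≤ ‖ι (polyLaplacian ξ p)‖ ^ 2 := by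
  have hadj' (j : Fin n) (q r) : inner ℂ (ι q) (ι (polyAdj ξ j r)) =
      inner ℂ (ι (pderiv (Sum.inr j) q)) (ι r) := by
    rw [← inner_conj_symm, hadj, inner_conj_symm]
  have key : inner ℂ (ι (polyLaplacian ξ p)) (ι (polyLaplacian ξ p)) =
      ((∑ k, ∑ j, ‖ι (pderiv (Sum.inr j) (pderiv (Sum.inr k) p))‖ ^ 2 +
        2 * ξ * ∑ j, ‖ι (pderiv (Sum.inr j) p)‖ ^ 2 : ℝ) : ℂ) := by
    have hL (q) : inner ℂ (ι (polyLaplacian ξ p)) (ι q) =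
        ∑ k, inner ℂ (ι (pderiv (Sum.inr k) p)) (ι (pderiv (Sum.inr k) q)) := by
      rw [polyLaplacian_apply, map_sum, sum_inner]
      simp only [hadj]
    have hcomm (k : Fin n) : pderiv (Sum.inr k) (polyLaplacian ξ p) =
        ∑ j, polyAdj ξ j (pderiv (Sum.inr j) (pderiv (Sum.inr k) p)) +
          (2 * ξ : ℂ) • pderiv (Sum.inr k) p := by
      simp [polyLaplacian_apply, pderiv_polyAdj, Finset.sum_add_distrib,
        pderiv_comm (Sum.inr k) (Sum.inr _) p]
    rw [hL]
    push_cast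
    rw [Finset.mul_sum, ← Finset.sum_add_distrib]
    refine Finset.sum_congr rfl fun k _ => ?_
    rw [hcomm, map_add, map_sum, inner_add_right, inner_sum, map_smul, inner_smul_right,
      inner_self_eq_norm_sq_to_K]
    congr 1
    refine Finset.sum_congr rfl fun j _ => ?_
    rw [hadj', inner_self_eq_norm_sq_to_K]
    rfl
  rw [inner_self_eq_norm_sq_to_K] at key
  have key' : ‖ι (polyLaplacian ξ p)‖ ^ 2 = _ :=
    Complex.ofReal_injective ((Complex.ofReal_pow _ 2).trans key)
  rw [key', le_add_iff_nonneg_left]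
  positivity

/-- Abstract form of the estimate: the distance from `x` to the closure `K` of the holomorphic
polynomials is controlled by the weak `∂̄`-derivatives `y j` of `x`. -/
lemma norm_sub_starProjection_sq_le [CompleteSpace H] {ξ : ℝ} (hξ : 0 < ξ)
    (ι : MvPolynomial (Fin n ⊕ Fin n) ℂ →ₗ[ℂ] H) (hdense : DenseRange ι)
    (hadj : ∀ j p q, inner ℂ (ι (polyAdj ξ j p)) (ι q) =
      inner ℂ (ι p) (ι (pderiv (Sum.inr j) q)))
    (K : Submodule ℂ H) (hK : K = (LinearMap.range (ι ∘ₗ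
      (rename (Sum.inl : Fin n → Fin n ⊕ Fin n)).toLinearMap)).topologicalClosure)
    [K.HasOrthogonalProjection]
    (x : H) (y : Fin n → H) (hxy : ∀ j p, inner ℂ (ι (polyAdj ξ j p)) x = inner ℂ (ι p) (y j)) :
    ‖x - K.starProjection x‖ ^ 2 ≤ 1 / (2 * ξ) * ∑ j, ‖y j‖ ^ 2 := by
  set v := x - K.starProjection x with hv
  set E := ∑ j, ‖y j‖ ^ 2 with hE
  have hE0 : 0 ≤ E := by positivity
  have hvK : ∀ g ∈ K, inner ℂ g v = 0 := fun g hg =>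
    (K.mem_orthogonal v).1 (K.sub_starProjection_mem_orthogonal x) g hg
  have hqK (q) : ι (rename Sum.inl q) ∈ K := by
    rw [hK]
    exact Submodule.le_topologicalClosure _ ⟨q, rfl⟩
  have hLhol (ψ q) : inner ℂ (ι (polyLaplacian ξ ψ)) (ι (rename Sum.inl q)) = 0 := by
    rw [polyLaplacian_apply, map_sum, sum_inner]
    refine Finset.sum_eq_zero fun j _ => ?_
    have h : pderiv (Sum.inr j : Fin n ⊕ Fin n) (rename Sum.inl q) = 0 :=
      pderiv_eq_zero_of_notMem_vars fun h => by simpa using vars_rename _ _ h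
    rw [hadj, h, map_zero, inner_zero_right]
  have hLK (ψ) : ∀ g ∈ K, inner ℂ (ι (polyLaplacian ξ ψ)) g = 0 := by
    intro g hg
    rw [hK] at hg
    have hcl : IsClosed {g : H | inner ℂ (ι (polyLaplacian ξ ψ)) g = 0} :=
      isClosed_eq (by fun_prop) continuous_const
    refine closure_minimal ?_ hcl hg
    rintro _ ⟨q, rfl⟩
    exact hLhol ψ q
  have hpoly (p) : ‖inner ℂ (ι p) v‖ ≤ √(1 / (2 * ξ) * E) * ‖ι p‖ := by
    obtain ⟨q, ψ, rfl⟩ := exists_eq_rename_add_polyLaplacian hξ p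
    have hpyth : ‖ι (polyLaplacian ξ ψ)‖ ≤ ‖ι (rename Sum.inl q + polyLaplacian ξ ψ)‖ := by
      have := norm_add_sq_eq_norm_sq_add_norm_sq_of_inner_eq_zero (𝕜 := ℂ) _ _ (hLhol ψ q)
      rw [add_comm, ← map_add] at this
      nlinarith [norm_nonneg (ι (rename Sum.inl q + polyLaplacian ξ ψ)),
        norm_nonneg (ι (rename Sum.inl q : MvPolynomial (Fin n ⊕ Fin n) ℂ)),
        norm_nonneg (ι (polyLaplacian ξ ψ))]
    have hsum : inner ℂ (ι (rename Sum.inl q + polyLaplacian ξ ψ)) v =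
        ∑ j, inner ℂ (ι (pderiv (Sum.inr j) ψ)) (y j) := by
      rw [map_add, inner_add_left, hvK _ (hqK q), zero_add, hv, inner_sub_right,
        hLK ψ _ (K.starProjection_apply_mem x), sub_zero, polyLaplacian_apply, map_sum, sum_inner]
      exact Finset.sum_congr rfl fun j _ => hxy j _
    have hcs : ‖∑ j, inner ℂ (ι (pderiv (Sum.inr j) ψ)) (y j)‖ ^ 2 ≤
        (∑ j, ‖ι (pderiv (Sum.inr j) ψ)‖ ^ 2) * E := by
      refine le_trans ?_ (Finset.sum_mul_sq_le_sq_mul_sq _ _ _)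
      gcongr
      exact (norm_sum_le _ _).trans (Finset.sum_le_sum fun j _ => norm_inner_le_norm _ _)
    have hbasic := sum_norm_pderiv_sq_le ξ ι hadj ψ
    rw [hsum]
    refine le_trans ?_ (mul_le_mul_of_nonneg_left hpyth (Real.sqrt_nonneg _))
    refine abs_le_of_sq_le_sq' ?_ (by positivity) |>.2
    rw [mul_pow, Real.sq_sqrt (by positivity)]
    refine hcs.trans ?_
    have : ∑ j, ‖ι (pderiv (Sum.inr j) ψ)‖ ^ 2 ≤ 1 / (2 * ξ) * ‖ι (polyLaplacian ξ ψ)‖ ^ 2 := by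
      rw [one_div, ← div_eq_inv_mul, le_div_iff₀ (by positivity)]
      linarith
    calc _ ≤ 1 / (2 * ξ) * ‖ι (polyLaplacian ξ ψ)‖ ^ 2 * E := by gcongr
      _ = _ := by ring
  have hall : ‖inner ℂ v v‖ ≤ √(1 / (2 * ξ) * E) * ‖v‖ :=
    hdense.induction_on (p := fun g => ‖inner ℂ g v‖ ≤ √(1 / (2 * ξ) * E) * ‖g‖) v
      (isClosed_le (by fun_prop) (by fun_prop)) hpoly
  rw [inner_self_eq_norm_sq_to_K, norm_pow] at hall
  simp only [RCLike.norm_ofReal, abs_norm] at hall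
  have hle : ‖v‖ ≤ √(1 / (2 * ξ) * E) := by
    rcases (norm_nonneg v).eq_or_lt with h | h
    · rw [← h]; positivity
    · rw [sq] at hall
      exact le_of_mul_le_mul_right hall h
  calc ‖v‖ ^ 2 ≤ √(1 / (2 * ξ) * E) ^ 2 := by gcongr
    _ = _ := Real.sq_sqrt (by positivity)

end Hilbert

/-- Evaluation of a polynomial in `z` and `z̄` at a point of `ℂⁿ`. -/
def polyEval {n : ℕ} (p : MvPolynomial (Fin n ⊕ Fin n) ℂ) (z : Fin n → ℂ) : ℂ :=
  MvPolynomial.eval (Sum.elim z fun j => starRingEnd ℂ (z j)) p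

section Evaluation

open MvPolynomial

variable {n : ℕ}

lemma nsq_nonneg (z : Fin n → ℂ) : 0 ≤ nsq z :=
  Finset.sum_nonneg fun _ _ => Complex.normSq_nonneg _

lemma continuous_nsq : Continuous (nsq : (Fin n → ℂ) → ℝ) :=
  continuous_finsetSum _ fun j _ => Complex.continuous_normSq.comp (continuous_apply j)

lemma norm_sq_le_nsq (z : Fin n → ℂ) : ‖z‖ ^ 2 ≤ nsq z := by
  rw [← Real.le_sqrt (norm_nonneg _) (nsq_nonneg z), pi_norm_le_iff_of_nonneg (Real.sqrt_nonneg _)]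
  intro j
  refine Real.le_sqrt_of_sq_le ?_
  rw [← Complex.normSq_eq_norm_sq]
  exact Finset.single_le_sum (f := fun j => Complex.normSq (z j))
    (fun _ _ => Complex.normSq_nonneg _) (Finset.mem_univ j)

@[simp] lemma polyEval_C (a : ℂ) (z : Fin n → ℂ) : polyEval (C a) z = a := by simp [polyEval]

@[simp] lemma polyEval_zero (z : Fin n → ℂ) : polyEval 0 z = 0 := by simp [polyEval]

@[simp] lemma polyEval_one (z : Fin n → ℂ) : polyEval 1 z = 1 := by simp [polyEval]

@[simp] lemma polyEval_add (p q : MvPolynomial (Fin n ⊕ Fin n) ℂ) (z : Fin n → ℂ) :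
    polyEval (p + q) z = polyEval p z + polyEval q z := by simp [polyEval]

@[simp] lemma polyEval_neg (p : MvPolynomial (Fin n ⊕ Fin n) ℂ) (z : Fin n → ℂ) :
    polyEval (-p) z = -polyEval p z := by simp [polyEval]

@[simp] lemma polyEval_sub (p q : MvPolynomial (Fin n ⊕ Fin n) ℂ) (z : Fin n → ℂ) :
    polyEval (p - q) z = polyEval p z - polyEval q z := by simp [polyEval]

@[simp] lemma polyEval_mul (p q : MvPolynomial (Fin n ⊕ Fin n) ℂ) (z : Fin n → ℂ) :
    polyEval (p * q) z = polyEval p z * polyEval q z := by simp [polyEval]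

@[simp] lemma polyEval_pow (p : MvPolynomial (Fin n ⊕ Fin n) ℂ) (k : ℕ) (z : Fin n → ℂ) :
    polyEval (p ^ k) z = polyEval p z ^ k := by simp [polyEval]

@[simp] lemma polyEval_smul (a : ℂ) (p : MvPolynomial (Fin n ⊕ Fin n) ℂ) (z : Fin n → ℂ) :
    polyEval (a • p) z = a * polyEval p z := by simp [polyEval, smul_eval]

@[simp] lemma polyEval_sum {ι : Type*} (s : Finset ι) (p : ι → MvPolynomial (Fin n ⊕ Fin n) ℂ)
    (z : Fin n → ℂ) : polyEval (∑ i ∈ s, p i) z = ∑ i ∈ s, polyEval (p i) z := by simp [polyEval]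

@[simp] lemma polyEval_X_inl (j : Fin n) (z : Fin n → ℂ) : polyEval (X (Sum.inl j)) z = z j := by
  simp [polyEval]

@[simp] lemma polyEval_X_inr (j : Fin n) (z : Fin n → ℂ) :
    polyEval (X (Sum.inr j)) z = starRingEnd ℂ (z j) := by simp [polyEval]

lemma differentiable_polyEval_rename_inl (q : MvPolynomial (Fin n) ℂ) :
    Differentiable ℂ (polyEval (rename (Sum.inl : Fin n → Fin n ⊕ Fin n) q)) := by
  induction q using MvPolynomial.induction_on with
  | C a =>
    have : polyEval (rename (Sum.inl : Fin n → Fin n ⊕ Fin n) (C a)) = fun _ => a := by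
      ext z; simp
    rw [this]
    exact differentiable_const a
  | add p q hp hq =>
    have : polyEval (rename (Sum.inl : Fin n → Fin n ⊕ Fin n) (p + q)) =
        polyEval (rename Sum.inl p) + polyEval (rename Sum.inl q) := by ext z; simp
    rw [this]
    exact hp.add hq
  | mul_X p j hp =>
    have : polyEval (rename (Sum.inl : Fin n → Fin n ⊕ Fin n) (p * X j)) =
        fun z => polyEval (rename Sum.inl p) z * z j := by ext z; simp
    rw [this]
    exact hp.mul (differentiable_apply j)

/-- The derivative of a polynomial in `z` and `z̄` in the direction `v`. -/
def polyDeriv (v : Fin n → ℂ) (p : MvPolynomial (Fin n ⊕ Fin n) ℂ) :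
    MvPolynomial (Fin n ⊕ Fin n) ℂ :=
  ∑ j, (v j • pderiv (Sum.inl j) p + starRingEnd ℂ (v j) • pderiv (Sum.inr j) p)

lemma polyDeriv_single (j : Fin n) (a : ℂ) (p : MvPolynomial (Fin n ⊕ Fin n) ℂ) :
    polyDeriv (Pi.single j a) p =
      a • pderiv (Sum.inl j) p + starRingEnd ℂ a • pderiv (Sum.inr j) p := by
  rw [polyDeriv, Finset.sum_eq_single j (fun k _ hk => by simp [hk]) (by simp)]
  simp

lemma polyDeriv_mul (v : Fin n → ℂ) (p q : MvPolynomial (Fin n ⊕ Fin n) ℂ) :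
    polyDeriv v (p * q) = p * polyDeriv v q + q * polyDeriv v p := by
  simp only [polyDeriv, Finset.mul_sum, ← Finset.sum_add_distrib, Derivation.leibniz, smul_eq_mul,
    smul_add, mul_add, mul_smul_comm]
  exact Finset.sum_congr rfl fun j _ => by abel

lemma differentiable_polyEval_and_fderiv (p : MvPolynomial (Fin n ⊕ Fin n) ℂ) (z : Fin n → ℂ) :
    DifferentiableAt ℝ (polyEval p) z ∧
      ∀ v, fderiv ℝ (polyEval p) z v = polyEval (polyDeriv v p) z := by
  induction p using MvPolynomial.induction_on with
  | C a =>
    have : polyEval (C a : MvPolynomial (Fin n ⊕ Fin n) ℂ) = fun _ => a := by ext z; simp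
    rw [this]
    refine ⟨differentiableAt_const a, fun v => ?_⟩
    simp [polyDeriv]
  | add p q hp hq =>
    have : polyEval (p + q) = polyEval p + polyEval q := by ext z; simp
    rw [this]
    refine ⟨hp.1.add hq.1, fun v => ?_⟩
    rw [fderiv_add hp.1 hq.1, add_apply, hp.2, hq.2, ← polyEval_add]
    congr 1
    simp only [polyDeriv, ← Finset.sum_add_distrib, map_add, smul_add]
    exact Finset.sum_congr rfl fun j _ => by abel
  | mul_X p i hp =>
    have hX : DifferentiableAt ℝ (polyEval (X i : MvPolynomial (Fin n ⊕ Fin n) ℂ)) z ∧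
        ∀ v, fderiv ℝ (polyEval (X i)) z v = polyEval (polyDeriv v (X i)) z := by
      rcases i with i | i
      · have : polyEval (X (Sum.inl i)) = ⇑(ContinuousLinearMap.proj (R := ℝ) i :
            (Fin n → ℂ) →L[ℝ] ℂ) := by ext z; simp
        rw [this]
        refine ⟨ContinuousLinearMap.differentiableAt _, fun v => ?_⟩
        rw [ContinuousLinearMap.fderiv]
        simp [polyDeriv, pderiv_X, Pi.single_apply]
      · have : polyEval (X (Sum.inr i)) = ⇑((Complex.conjCLE : ℂ →L[ℝ] ℂ).comp
            (ContinuousLinearMap.proj (R := ℝ) i : (Fin n → ℂ) →L[ℝ] ℂ)) := by ext z; simp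
        rw [this]
        refine ⟨ContinuousLinearMap.differentiableAt _, fun v => ?_⟩
        rw [ContinuousLinearMap.fderiv]
        simp [polyDeriv, pderiv_X, Pi.single_apply]
    have : polyEval (p * X i) = fun z => polyEval p z * polyEval (X i) z := by ext z; simp
    rw [this]
    refine ⟨hp.1.mul hX.1, fun v => ?_⟩
    rw [fderiv_fun_mul hp.1 hX.1, polyDeriv_mul]
    simp [hp.2, hX.2]

lemma differentiable_polyEval (p : MvPolynomial (Fin n ⊕ Fin n) ℂ) :
    Differentiable ℝ (polyEval p) := fun z => (differentiable_polyEval_and_fderiv p z).1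

lemma fderiv_polyEval (p : MvPolynomial (Fin n ⊕ Fin n) ℂ) (z v : Fin n → ℂ) :
    fderiv ℝ (polyEval p) z v = polyEval (polyDeriv v p) z :=
  (differentiable_polyEval_and_fderiv p z).2 v

lemma dZbarC_polyEval (j : Fin n) (p : MvPolynomial (Fin n ⊕ Fin n) ℂ) :
    dZbarC j (polyEval p) = polyEval (pderiv (Sum.inr j) p) := by
  ext z
  rw [dZbarC, fderiv_polyEval, fderiv_polyEval, polyDeriv_single, polyDeriv_single]
  simp only [polyEval_add, polyEval_smul, map_one, Complex.conj_I]
  linear_combination (1 / 2 * polyEval (pderiv (Sum.inl j) p) z -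
    1 / 2 * polyEval (pderiv (Sum.inr j) p) z) * Complex.I_mul_I

lemma exists_norm_polyEval_le (p : MvPolynomial (Fin n ⊕ Fin n) ℂ) {δ : ℝ} (hδ : 0 < δ) :
    ∃ M, ∀ z, ‖polyEval p z‖ ≤ M * Real.exp (δ * nsq z) := by
  induction p using MvPolynomial.induction_on generalizing δ with
  | C a =>
    refine ⟨‖a‖, fun z => ?_⟩
    rw [polyEval_C]
    exact le_mul_of_one_le_right (norm_nonneg _)
      (Real.one_le_exp (mul_nonneg hδ.le (nsq_nonneg z)))
  | add p q hp hq =>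
    obtain ⟨M, hM⟩ := hp hδ
    obtain ⟨M', hM'⟩ := hq hδ
    refine ⟨M + M', fun z => ?_⟩
    rw [polyEval_add, add_mul]
    exact (norm_add_le _ _).trans (add_le_add (hM z) (hM' z))
  | mul_X p i hp =>
    obtain ⟨M, hM⟩ := hp (half_pos hδ)
    refine ⟨M * (1 + (δ / 2)⁻¹), fun z => ?_⟩
    have hX : ‖polyEval (X i) z‖ ≤ ‖z‖ := by
      rcases i with i | i
      · simpa using norm_le_pi_norm z i
      · simpa using norm_le_pi_norm z i
    have hz : ‖z‖ ≤ (1 + (δ / 2)⁻¹) * Real.exp (δ / 2 * nsq z) := by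
      have h1 := norm_sq_le_nsq z
      have h2 := Real.add_one_le_exp (δ / 2 * nsq z)
      have h3 : nsq z = (δ / 2)⁻¹ * (δ / 2 * nsq z) := by field_simp
      have h4 : 0 < (δ / 2)⁻¹ := by positivity
      have h5 := mul_le_mul_of_nonneg_left h2 h4.le
      have h6 := Real.one_le_exp (mul_nonneg (half_pos hδ).le (nsq_nonneg z))
      nlinarith [sq_nonneg (‖z‖ - 1)]
    rw [polyEval_mul, norm_mul]
    have hM0 := hM z
    calc _ ≤ (M * Real.exp (δ / 2 * nsq z)) * ((1 + (δ / 2)⁻¹) * Real.exp (δ / 2 * nsq z)) :=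
          mul_le_mul hM0 (hX.trans hz) (norm_nonneg _) ((norm_nonneg _).trans hM0)
      _ = M * (1 + (δ / 2)⁻¹) * (Real.exp (δ / 2 * nsq z) * Real.exp (δ / 2 * nsq z)) := by ring
      _ = _ := by rw [← Real.exp_add]; ring_nf

end Evaluation

section Characteristic

variable {E : Type*} [NormedAddCommGroup E] [NormedSpace ℝ E] [CompleteSpace E]
  [MeasurableSpace E] [BorelSpace E] [SecondCountableTopology E] {μ : Measure E}

lemma ae_eq_zero_of_forall_integral_ofReal_mul_cexp_eq_zero {g : E → ℝ} (hg : Integrable g μ)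
    (h : ∀ L : StrongDual ℝ E, ∫ z, (g z : ℂ) * Complex.exp (L z * Complex.I) ∂μ = 0) :
    g =ᵐ[μ] 0 := by
  have hfin (g : E → ℝ) (hg : Integrable g μ) :
      IsFiniteMeasure (μ.withDensity fun z => ENNReal.ofReal (g z)) :=
    isFiniteMeasure_withDensity_ofReal hg.2
  have hchar (g : E → ℝ) (hg : Integrable g μ) (L : StrongDual ℝ E) :
      charFunDual (μ.withDensity fun z => ENNReal.ofReal (g z)) L =
        ∫ z, (max (g z) 0 : ℝ) • Complex.exp (L z * Complex.I) ∂μ := by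
    rw [charFunDual_apply, integral_withDensity_eq_integral_toReal_smul₀
      hg.1.aemeasurable.ennreal_ofReal (ae_of_all _ fun z => ENNReal.ofReal_lt_top)]
    simp [ENNReal.toReal_ofReal']
  have hint (g : E → ℝ) (hg : Integrable g μ) (L : StrongDual ℝ E) :
      Integrable (fun z => (max (g z) 0 : ℝ) • Complex.exp (L z * Complex.I)) μ := by
    refine hg.pos_part.smul_bdd 1 (Continuous.aestronglyMeasurable (by fun_prop))
      (ae_of_all _ fun z => ?_)
    rw [Complex.norm_exp_ofReal_mul_I]
  have hneg : Integrable (fun z => -g z) μ := hg.neg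
  have := hfin g hg
  have := hfin _ hneg
  have heq : (μ.withDensity fun z => ENNReal.ofReal (g z)) =
      μ.withDensity fun z => ENNReal.ofReal (-g z) := by
    refine Measure.ext_of_charFunDual (funext fun L => ?_)
    rw [hchar g hg, hchar _ hneg, ← sub_eq_zero, ← integral_sub (hint g hg L) (hint _ hneg L),
      ← h L]
    refine integral_congr_ae (ae_of_all _ fun z => ?_)
    dsimp only
    rw [← sub_smul, max_zero_sub_max_neg_zero_eq_self, Complex.real_smul]
  rw [withDensity_eq_iff hg.1.aemeasurable.ennreal_ofReal hneg.1.aemeasurable.ennreal_ofReal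
    hg.lintegral_lt_top.ne] at heq
  filter_upwards [heq] with z hz
  rcases le_total (g z) 0 with h0 | h0
  · rw [ENNReal.ofReal_of_nonpos h0, eq_comm, ENNReal.ofReal_eq_zero] at hz
    simp only [Pi.zero_apply]; linarith
  · rw [ENNReal.ofReal_of_nonpos (neg_nonpos.2 h0), ENNReal.ofReal_eq_zero] at hz
    simp only [Pi.zero_apply]; linarith

lemma ae_eq_zero_of_forall_integral_mul_cexp_eq_zero {f : E → ℂ} (hf : Integrable f μ)
    (h : ∀ L : StrongDual ℝ E, ∫ z, f z * Complex.exp (L z * Complex.I) ∂μ = 0) :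
    f =ᵐ[μ] 0 := by
  have hint (f : E → ℂ) (hf : Integrable f μ) (L : StrongDual ℝ E) :
      Integrable (fun z => f z * Complex.exp (L z * Complex.I)) μ := by
    refine hf.mul_bdd (c := 1) (Continuous.aestronglyMeasurable (by fun_prop))
      (ae_of_all _ fun z => ?_)
    rw [Complex.norm_exp_ofReal_mul_I]
  have hconj (L : StrongDual ℝ E) :
      ∫ z, starRingEnd ℂ (f z) * Complex.exp (L z * Complex.I) ∂μ = 0 := by
    have := congrArg (starRingEnd ℂ) (h (-L))
    rw [← integral_conj, map_zero] at this
    rw [← this]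
    refine integral_congr_ae (ae_of_all _ fun z => ?_)
    simp [← Complex.exp_conj]
  have hcint : Integrable (fun z => starRingEnd ℂ (f z)) μ :=
    (Complex.conjCLE : ℂ →L[ℝ] ℂ).integrable_comp hf
  have hre := ae_eq_zero_of_forall_integral_ofReal_mul_cexp_eq_zero hf.re fun L => by
    have := congrArg₂ (fun a b : ℂ => (1 / 2) * (a + b)) (h L) (hconj L)
    rw [add_zero, mul_zero, ← integral_add (hint f hf L) (hint _ hcint L),
      ← integral_const_mul] at this
    rw [← this]
    refine integral_congr_ae (ae_of_all _ fun z => ?_)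
    simp only [RCLike.re_eq_complex_re, Complex.re_eq_add_conj]
    ring
  have him := ae_eq_zero_of_forall_integral_ofReal_mul_cexp_eq_zero hf.im fun L => by
    have := congrArg₂ (fun a b : ℂ => (1 / (2 * Complex.I)) * (a - b)) (h L) (hconj L)
    rw [sub_zero, mul_zero, ← integral_sub (hint f hf L) (hint _ hcint L),
      ← integral_const_mul] at this
    rw [← this]
    refine integral_congr_ae (ae_of_all _ fun z => ?_)
    simp only [RCLike.im_eq_complex_im, Complex.im_eq_sub_conj]
    ring
  filter_upwards [hre, him] with z h1 h2
  exact Complex.ext h1 h2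

end Characteristic

section Gaussian

variable {n : ℕ} {ξ : ℝ}

lemma measurable_gaussDensity (ξ : ℝ) :
    Measurable fun z : Fin n → ℂ => ENNReal.ofReal (Real.exp (-2 * ξ * nsq z)) :=
  (Real.continuous_exp.comp (continuous_const.mul continuous_nsq)).measurable.ennreal_ofReal

lemma integrable_gaussMeasure_iff {F : Type*} [NormedAddCommGroup F] [NormedSpace ℝ F]
    {g : (Fin n → ℂ) → F} :
    Integrable g (gaussMeasure n ξ) ↔
      Integrable (fun z => Real.exp (-2 * ξ * nsq z) • g z) := by
  rw [gaussMeasure, integrable_withDensity_iff_integrable_smul' (measurable_gaussDensity ξ)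
    (ae_of_all _ fun z => ENNReal.ofReal_lt_top)]
  simp_rw [ENNReal.toReal_ofReal (Real.exp_pos _).le]

lemma integral_gaussMeasure {F : Type*} [NormedAddCommGroup F] [NormedSpace ℝ F]
    (g : (Fin n → ℂ) → F) :
    ∫ z, g z ∂(gaussMeasure n ξ) = ∫ z, Real.exp (-2 * ξ * nsq z) • g z := by
  rw [gaussMeasure, integral_withDensity_eq_integral_toReal_smul (measurable_gaussDensity ξ)
    (ae_of_all _ fun z => ENNReal.ofReal_lt_top)]
  simp_rw [ENNReal.toReal_ofReal (Real.exp_pos _).le]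

lemma integrable_exp_neg_mul_nsq {c : ℝ} (hc : 0 < c) :
    Integrable fun z : Fin n → ℂ => Real.exp (-c * nsq z) := by
  have h1 : Integrable fun w : ℂ => Real.exp (-c * Complex.normSq w) := by
    have h := (GaussianFourier.integrable_cexp_neg_mul_sq_norm_add (V := ℂ) (b := (c : ℂ))
      (by simpa using hc) 0 0).norm
    refine h.congr (ae_of_all _ fun w => ?_)
    simp only [Complex.norm_exp, Complex.normSq_eq_norm_sq]
    simp [← Complex.ofReal_pow, ← Complex.ofReal_mul, ← Complex.ofReal_neg]
  have h := Integrable.fintype_prod (f := fun (_ : Fin n) w => Real.exp (-c * Complex.normSq w))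
    fun _ => h1
  refine h.congr (ae_of_all _ fun z => ?_)
  simp only [nsq, Finset.mul_sum, Real.exp_sum]

lemma memLp_gaussMeasure_of_le (hξ : 0 < ξ) {g : (Fin n → ℂ) → ℂ} (hg : Continuous g) {M : ℝ}
    (hM : ∀ z, ‖g z‖ ≤ M * Real.exp (ξ / 2 * nsq z)) : MemLp g 2 (gaussMeasure n ξ) := by
  rw [memLp_two_iff_integrable_sq_norm hg.aestronglyMeasurable, integrable_gaussMeasure_iff]
  refine ((integrable_exp_neg_mul_nsq hξ).const_mul (M ^ 2)).mono' ?_ (ae_of_all _ fun z => ?_)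
  · have := continuous_nsq (n := n)
    exact Continuous.aestronglyMeasurable (by fun_prop)
  · rw [norm_smul, Real.norm_of_nonneg (Real.exp_pos _).le, Real.norm_of_nonneg (sq_nonneg _)]
    calc _ ≤ Real.exp (-2 * ξ * nsq z) * (M * Real.exp (ξ / 2 * nsq z)) ^ 2 := by
          gcongr; exact hM z
      _ = M ^ 2 * (Real.exp (-2 * ξ * nsq z) * (Real.exp (ξ / 2 * nsq z) *
          Real.exp (ξ / 2 * nsq z))) := by ring
      _ = _ := by rw [← Real.exp_add, ← Real.exp_add]; ring_nf

lemma memLp_polyEval (hξ : 0 < ξ) (p : MvPolynomial (Fin n ⊕ Fin n) ℂ) :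
    MemLp (polyEval p) 2 (gaussMeasure n ξ) := by
  obtain ⟨M, hM⟩ := exists_norm_polyEval_le p (half_pos hξ)
  exact memLp_gaussMeasure_of_le hξ (differentiable_polyEval p).continuous hM

/-- Polynomials in `z` and `z̄` as elements of `L²` of the Gaussian measure. -/
def polyToLp (hξ : 0 < ξ) :
    MvPolynomial (Fin n ⊕ Fin n) ℂ →ₗ[ℂ] Lp ℂ 2 (gaussMeasure n ξ) where
  toFun p := (memLp_polyEval hξ p).toLp (polyEval p)
  map_add' p q := by
    rw [← MemLp.toLp_add]
    exact MemLp.toLp_congr (memLp_polyEval hξ _) _ (ae_of_all _ fun z => polyEval_add p q z)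
  map_smul' a p := by
    rw [RingHom.id_apply, ← MemLp.toLp_const_smul]
    exact MemLp.toLp_congr (memLp_polyEval hξ _) _ (ae_of_all _ fun z => polyEval_smul a p z)

lemma coeFn_polyToLp (hξ : 0 < ξ) (p : MvPolynomial (Fin n ⊕ Fin n) ℂ) :
    ⇑(polyToLp hξ p) =ᵐ[gaussMeasure n ξ] polyEval p :=
  MemLp.coeFn_toLp (memLp_polyEval hξ p)

lemma inner_polyToLp (hξ : 0 < ξ) (p : MvPolynomial (Fin n ⊕ Fin n) ℂ)
    (f : Lp ℂ 2 (gaussMeasure n ξ)) {g : (Fin n → ℂ) → ℂ} (hfg : ⇑f =ᵐ[gaussMeasure n ξ] g) :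
    inner ℂ (polyToLp hξ p) f =
      ∫ z, g z * starRingEnd ℂ (polyEval p z) ∂(gaussMeasure n ξ) := by
  rw [L2.inner_def]
  refine integral_congr_ae ?_
  filter_upwards [coeFn_polyToLp hξ p, hfg] with z h1 h2
  rw [h1, h2, RCLike.inner_apply]

end Gaussian

section IntegrationByParts

open MvPolynomial

variable {n : ℕ} {ξ : ℝ}

/-- The polynomial `|z|²`. -/
def nsqPoly (n : ℕ) : MvPolynomial (Fin n ⊕ Fin n) ℂ := ∑ j, X (Sum.inl j) * X (Sum.inr j)

lemma polyEval_nsqPoly (z : Fin n → ℂ) : polyEval (nsqPoly n) z = (nsq z : ℂ) := by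
  simp [nsqPoly, nsq, Complex.mul_conj]

lemma pderiv_inl_nsqPoly (j : Fin n) : pderiv (Sum.inl j) (nsqPoly n) = X (Sum.inr j) := by
  simp [nsqPoly, Derivation.leibniz, pderiv_X, Pi.single_apply]

lemma pderiv_inr_nsqPoly (j : Fin n) : pderiv (Sum.inr j) (nsqPoly n) = X (Sum.inl j) := by
  simp [nsqPoly, Derivation.leibniz, pderiv_X, Pi.single_apply]

lemma fderiv_conj_polyEval_mul_exp (ξ : ℝ) (p : MvPolynomial (Fin n ⊕ Fin n) ℂ)
    (z : Fin n → ℂ) :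
    DifferentiableAt ℝ
      (fun z => starRingEnd ℂ (polyEval p z) * (Real.exp (-2 * ξ * nsq z) : ℂ)) z ∧
    ∀ v, fderiv ℝ (fun z => starRingEnd ℂ (polyEval p z) * (Real.exp (-2 * ξ * nsq z) : ℂ)) z v =
      (Real.exp (-2 * ξ * nsq z) : ℂ) * (starRingEnd ℂ (polyEval (polyDeriv v p) z) -
        2 * ξ * (polyEval (polyDeriv v (nsqPoly n)) z * starRingEnd ℂ (polyEval p z))) := by
  have hw : (fun z : Fin n → ℂ => (Real.exp (-2 * ξ * nsq z) : ℂ)) =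
      fun z => Complex.exp ((-2 * ξ : ℂ) * polyEval (nsqPoly n) z) := by
    ext z; simp [polyEval_nsqPoly]
  have h1 := (differentiable_polyEval p z).hasFDerivAt
  have h2 := ((differentiable_polyEval (nsqPoly n) z).hasFDerivAt.const_mul (-2 * ξ : ℂ)).cexp
  rw [← congrFun hw z, ← hw] at h2
  have h3 := ((Complex.conjCLE : ℂ →L[ℝ] ℂ).hasFDerivAt.comp z h1).mul h2
  refine ⟨h3.differentiableAt, fun v => ?_⟩
  refine (congrArg (fun L : (Fin n → ℂ) →L[ℝ] ℂ => L v) h3.fderiv).trans ?_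
  simp [fderiv_polyEval]
  ring

lemma memLp_conj_polyEval (hξ : 0 < ξ) (p : MvPolynomial (Fin n ⊕ Fin n) ℂ) :
    MemLp (fun z => starRingEnd ℂ (polyEval p z)) 2 (gaussMeasure n ξ) :=
  (memLp_polyEval hξ p).star

lemma integral_fderiv_mul_conj_polyEval (hξ : 0 < ξ) {f : (Fin n → ℂ) → ℂ}
    (hf : Differentiable ℝ f) (hfL : MemLp f 2 (gaussMeasure n ξ)) (v : Fin n → ℂ)
    (hdf : MemLp (fun z => fderiv ℝ f z v) 2 (gaussMeasure n ξ))
    (p : MvPolynomial (Fin n ⊕ Fin n) ℂ) :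
    Integrable (fun z => f z * (starRingEnd ℂ (polyEval (polyDeriv v p) z) -
        2 * ξ * (polyEval (polyDeriv v (nsqPoly n)) z * starRingEnd ℂ (polyEval p z))))
      (gaussMeasure n ξ) ∧
    ∫ z, fderiv ℝ f z v * starRingEnd ℂ (polyEval p z) ∂(gaussMeasure n ξ) =
      -∫ z, f z * (starRingEnd ℂ (polyEval (polyDeriv v p) z) -
        2 * ξ * (polyEval (polyDeriv v (nsqPoly n)) z * starRingEnd ℂ (polyEval p z)))
        ∂(gaussMeasure n ξ) := by
  have hmix : MemLp (fun z => polyEval (polyDeriv v (nsqPoly n)) z *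
      starRingEnd ℂ (polyEval p z)) 2 (gaussMeasure n ξ) := by
    refine (memLp_polyEval hξ (polyDeriv v (nsqPoly n) * p)).congr_norm
      (Continuous.aestronglyMeasurable ?_) (ae_of_all _ fun z => by simp)
    have h1 := (differentiable_polyEval (polyDeriv v (nsqPoly n))).continuous
    have h2 := (differentiable_polyEval p).continuous
    fun_prop
  have hint := hfL.integrable_mul
    ((memLp_conj_polyEval hξ (polyDeriv v p)).sub (hmix.const_mul (2 * ξ : ℂ)))
  refine ⟨hint, ?_⟩
  have hibp := integral_mul_fderiv_eq_neg_fderiv_mul_of_integrable (μ := volume) (f := f)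
    (g := fun z => starRingEnd ℂ (polyEval p z) * (Real.exp (-2 * ξ * nsq z) : ℂ)) (v := v)
    ?_ ?_ ?_ (fun z _ => hf z) (fun z _ => (fderiv_conj_polyEval_mul_exp ξ p z).1)
  · rw [integral_gaussMeasure, integral_gaussMeasure, eq_neg_iff_add_eq_zero,
      add_comm, ← eq_neg_iff_add_eq_zero]
    refine Eq.trans (integral_congr_ae (ae_of_all _ fun z => ?_))
      (hibp.trans (congrArg Neg.neg (integral_congr_ae (ae_of_all _ fun z => ?_))))
    · dsimp only
      rw [(fderiv_conj_polyEval_mul_exp ξ p z).2, Complex.real_smul]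
      ring
    · dsimp only
      rw [Complex.real_smul]
      ring
  · refine (integrable_gaussMeasure_iff.1 (hdf.integrable_mul (memLp_conj_polyEval hξ p))).congr
      (ae_of_all _ fun z => ?_)
    simp only [Pi.mul_apply, Complex.real_smul]
    ring
  · refine (integrable_gaussMeasure_iff.1 hint).congr (ae_of_all _ fun z => ?_)
    dsimp only
    rw [(fderiv_conj_polyEval_mul_exp ξ p z).2, Complex.real_smul]
    simp only [Pi.mul_apply, Pi.sub_apply]
    ring
  · refine (integrable_gaussMeasure_iff.1 (hfL.integrable_mul (memLp_conj_polyEval hξ p))).congr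
      (ae_of_all _ fun z => ?_)
    simp only [Pi.mul_apply, Complex.real_smul]
    ring

lemma integral_mul_conj_polyEval_polyAdj (hξ : 0 < ξ) {f : (Fin n → ℂ) → ℂ}
    (hf : Differentiable ℝ f) (hfL : MemLp f 2 (gaussMeasure n ξ))
    (hdf : ∀ v, MemLp (fun z => fderiv ℝ f z v) 2 (gaussMeasure n ξ)) (j : Fin n)
    (p : MvPolynomial (Fin n ⊕ Fin n) ℂ) :
    ∫ z, f z * starRingEnd ℂ (polyEval (polyAdj ξ j p) z) ∂(gaussMeasure n ξ) =
      ∫ z, dZbarC j f z * starRingEnd ℂ (polyEval p z) ∂(gaussMeasure n ξ) := by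
  obtain ⟨hint1, h1⟩ := integral_fderiv_mul_conj_polyEval hξ hf hfL (Pi.single j 1) (hdf _) p
  obtain ⟨hintI, hI⟩ :=
    integral_fderiv_mul_conj_polyEval hξ hf hfL (Pi.single j Complex.I) (hdf _) p
  have hd (v : Fin n → ℂ) : Integrable (fun z => fderiv ℝ f z v * starRingEnd ℂ (polyEval p z))
      (gaussMeasure n ξ) := (hdf v).integrable_mul (memLp_conj_polyEval hξ p)
  have hR : ∫ z, dZbarC j f z * starRingEnd ℂ (polyEval p z) ∂(gaussMeasure n ξ) =
      1 / 2 * (∫ z, fderiv ℝ f z (Pi.single j 1) * starRingEnd ℂ (polyEval p z)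
        ∂(gaussMeasure n ξ)) + Complex.I / 2 * ∫ z, fderiv ℝ f z (Pi.single j Complex.I) *
          starRingEnd ℂ (polyEval p z) ∂(gaussMeasure n ξ) := by
    rw [← integral_const_mul, ← integral_const_mul,
      ← integral_add ((hd _).const_mul _) ((hd _).const_mul _)]
    refine integral_congr_ae (ae_of_all _ fun z => ?_)
    simp only [dZbarC]
    ring
  rw [hR, h1, hI, mul_neg, mul_neg, ← neg_mul, ← neg_mul, ← integral_const_mul,
    ← integral_const_mul, ← integral_add (hint1.const_mul _) (hintI.const_mul _)]
  refine integral_congr_ae (ae_of_all _ fun z => ?_)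
  simp only [polyDeriv_single, pderiv_inl_nsqPoly, pderiv_inr_nsqPoly, polyAdj_apply, polyEval_add,
    polyEval_neg, polyEval_smul, polyEval_mul, polyEval_X_inl, polyEval_X_inr, map_add, map_neg,
    map_mul, map_one, Complex.conj_I, Complex.conj_ofReal, Complex.conj_conj, map_ofNat]
  ring_nf
  simp only [Complex.I_sq]
  ring

lemma inner_polyToLp_polyAdj (hξ : 0 < ξ) (j : Fin n) {f : (Fin n → ℂ) → ℂ}
    (hf : Differentiable ℝ f) (hdf : ∀ v, MemLp (fun z => fderiv ℝ f z v) 2 (gaussMeasure n ξ))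
    {F G : Lp ℂ 2 (gaussMeasure n ξ)} (hF : ⇑F =ᵐ[gaussMeasure n ξ] f)
    (hG : ⇑G =ᵐ[gaussMeasure n ξ] dZbarC j f) (p : MvPolynomial (Fin n ⊕ Fin n) ℂ) :
    inner ℂ (polyToLp hξ (polyAdj ξ j p)) F = inner ℂ (polyToLp hξ p) G := by
  rw [inner_polyToLp hξ _ _ hF, inner_polyToLp hξ _ _ hG]
  exact integral_mul_conj_polyEval_polyAdj hξ hf ((memLp_congr_ae hF).1 (Lp.memLp F)) hdf j p

end IntegrationByParts

section Density

open MvPolynomial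

variable {n : ℕ} {ξ : ℝ}

lemma exists_polyEval_eq_strongDual (L : StrongDual ℝ (Fin n → ℂ)) :
    ∃ p, ∀ z, polyEval p z = (L z : ℂ) := by
  refine ⟨∑ j, ((L (Pi.single j 1) / 2 : ℂ) • (X (Sum.inl j) + X (Sum.inr j)) +
    (L (Pi.single j Complex.I) / (2 * Complex.I) : ℂ) • (X (Sum.inl j) - X (Sum.inr j))),
    fun z => ?_⟩
  have hz : z = ∑ j, ((z j).re • (Pi.single j 1 : Fin n → ℂ) +
      (z j).im • (Pi.single j Complex.I : Fin n → ℂ)) := by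
    ext k
    simp [Finset.sum_apply, Pi.single_apply, Finset.sum_add_distrib]
  conv_rhs => rw [hz]
  simp only [map_sum, map_add, map_smul, smul_eq_mul, polyEval_sum, polyEval_add, polyEval_sub,
    polyEval_smul, polyEval_X_inl, polyEval_X_inr, Complex.ofReal_sum, Complex.ofReal_add,
    Complex.ofReal_mul, Complex.re_eq_add_conj, Complex.im_eq_sub_conj]
  exact Finset.sum_congr rfl fun j _ => by ring

lemma memLp_cexp_abs_strongDual (hξ : 0 < ξ) (L : StrongDual ℝ (Fin n → ℂ)) :
    MemLp (fun z => Complex.exp (|L z| : ℝ)) 2 (gaussMeasure n ξ) := by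
  refine memLp_gaussMeasure_of_le hξ (by fun_prop) (M := Real.exp (‖L‖ ^ 2 / (2 * ξ))) fun z => ?_
  rw [Complex.norm_exp_ofReal, ← Real.exp_add, Real.exp_le_exp]
  have h1 : |L z| ≤ ‖L‖ * ‖z‖ := L.le_opNorm z
  have h2 : ξ / 2 * ‖z‖ ^ 2 ≤ ξ / 2 * nsq z :=
    mul_le_mul_of_nonneg_left (norm_sq_le_nsq z) (half_pos hξ).le
  have h3 : ‖L‖ ^ 2 / (2 * ξ) + ξ / 2 * ‖z‖ ^ 2 - ‖L‖ * ‖z‖ = (‖L‖ - ξ * ‖z‖) ^ 2 / (2 * ξ) := by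
    field_simp
    ring
  have h4 : 0 ≤ (‖L‖ - ξ * ‖z‖) ^ 2 / (2 * ξ) := by positivity
  linarith

lemma denseRange_polyToLp (hξ : 0 < ξ) :
    DenseRange (polyToLp hξ : MvPolynomial (Fin n ⊕ Fin n) ℂ → Lp ℂ 2 (gaussMeasure n ξ)) := by
  have horth : (LinearMap.range (polyToLp (n := n) hξ))ᗮ = ⊥ := by
    rw [Submodule.eq_bot_iff]
    intro f hf
    have hf0 (p) : ∫ z, f z * starRingEnd ℂ (polyEval p z) ∂(gaussMeasure n ξ) = 0 := by
      rw [← inner_polyToLp hξ p f (ae_eq_refl _)]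
      exact (Submodule.mem_orthogonal _ _).1 hf _ ⟨p, rfl⟩
    have hfint : Integrable f (gaussMeasure n ξ) := by
      refine ((Lp.memLp f).integrable_mul (memLp_polyEval hξ 1)).congr (ae_of_all _ fun z => ?_)
      simp
    refine (Lp.eq_zero_iff_ae_eq_zero).2 (ae_eq_zero_of_forall_integral_mul_cexp_eq_zero hfint ?_)
    intro L
    obtain ⟨ℓ, hℓ⟩ := exists_polyEval_eq_strongDual L
    have hzero (N : ℕ) : ∫ z, f z * ∑ k ∈ Finset.range N, (L z * Complex.I) ^ k / (k.factorial : ℂ)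
        ∂(gaussMeasure n ξ) = 0 := by
      rw [← hf0 (∑ k ∈ Finset.range N, (k.factorial : ℂ)⁻¹ • ((-Complex.I) • ℓ) ^ k)]
      refine integral_congr_ae (ae_of_all _ fun z => ?_)
      simp only [polyEval_sum, polyEval_smul, polyEval_pow, hℓ, map_sum, map_mul, map_pow,
        map_inv₀, map_natCast, map_neg, Complex.conj_I, Complex.conj_ofReal, neg_neg]
      congr 1
      exact Finset.sum_congr rfl fun k _ => by rw [mul_comm (L z : ℂ), div_eq_inv_mul]
    have hexp (w : ℂ) : HasSum (fun k => w ^ k / (k.factorial : ℂ)) (Complex.exp w) := by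
      rw [Complex.exp_eq_exp_ℂ]
      exact NormedSpace.expSeries_div_hasSum_exp w
    have hlim := tendsto_integral_of_dominated_convergence
      (F := fun N z => f z * ∑ k ∈ Finset.range N, (L z * Complex.I) ^ k / (k.factorial : ℂ))
      (f := fun z => f z * Complex.exp (L z * Complex.I)) (μ := gaussMeasure n ξ)
      (fun z => ‖f z * Complex.exp (|L z| : ℝ)‖)
      (fun N => hfint.1.mul (Continuous.aestronglyMeasurable (by fun_prop)))
      ((Lp.memLp f).integrable_mul (memLp_cexp_abs_strongDual hξ L)).norm
      (fun N => ae_of_all _ fun z => ?_)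
      (ae_of_all _ fun z => (hexp _).tendsto_sum_nat.const_mul _)
    · simp only [hzero] at hlim
      exact (tendsto_nhds_unique hlim tendsto_const_nhds)
    · rw [norm_mul, norm_mul, Complex.norm_exp_ofReal]
      gcongr
      refine (norm_sum_le _ _).trans (le_trans (le_of_eq ?_)
        (Real.sum_le_exp_of_nonneg (abs_nonneg (L z)) N))
      exact Finset.sum_congr rfl fun k _ => by simp
  have := Submodule.topologicalClosure_eq_top_iff.2 horth
  rw [← Submodule.dense_iff_topologicalClosure_eq_top] at this
  exact this

end Density

/-- The squared norm in `L²` as an integral. -/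
lemma Lp_norm_sq_eq_integral {α : Type*} [MeasurableSpace α] {μ : Measure α} (f : Lp ℂ 2 μ) :
    ‖f‖ ^ 2 = ∫ z, ‖f z‖ ^ 2 ∂μ := by
  have h := L2.inner_def (𝕜 := ℂ) f f
  simp_rw [inner_self_eq_norm_sq_to_K] at h
  have h' : ((‖f‖ ^ 2 : ℝ) : ℂ) = ((∫ z, ‖f z‖ ^ 2 ∂μ : ℝ) : ℂ) := by
    refine (by simpa using h : ((‖f‖ ^ 2 : ℝ) : ℂ) = _).trans integral_complex_ofReal
  exact Complex.ofReal_injective h'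


/-- Hörmander-type estimate for the Fock space projection B_ξ:
∫ |(1−B_ξ)u|² e^{−2ξ|z|²} ≤ (2/ξ) ∫ Σⱼ |∂_{z̄ⱼ}u|² e^{−2ξ|z|²} for u ∈ C_c^∞(ℂⁿ). -/
theorem Fock_projection_estimate (n : ℕ) (ξ : ℝ) (hξ : 0 < ξ)
    (B : Lp ℂ 2 (gaussMeasure n ξ) →L[ℂ] Lp ℂ 2 (gaussMeasure n ξ))
    (hBmem : ∀ f, B f ∈ FockSet n ξ)
    (hBorth : ∀ f, ∀ g ∈ FockSet n ξ, inner (𝕜 := ℂ) (f - B f) g = 0)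
    (u : (Fin n → ℂ) → ℂ) (hu : ContDiff ℝ ∞ u) (huc : HasCompactSupport u)
    (uL : Lp ℂ 2 (gaussMeasure n ξ)) (huL : (⇑uL : (Fin n → ℂ) → ℂ) =ᵐ[gaussMeasure n ξ] u) :
    ∫ z : Fin n → ℂ, ‖(⇑(uL - B uL) : (Fin n → ℂ) → ℂ) z‖ ^ 2 ∂(gaussMeasure n ξ)
      ≤ (2 / ξ) *
        ∫ z : Fin n → ℂ, (∑ j, ‖dZbarC j u z‖ ^ 2) ∂(gaussMeasure n ξ) := by
  have hmem {g : (Fin n → ℂ) → ℂ} (hg : Continuous g) (hgc : HasCompactSupport g) :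
      MemLp g 2 (gaussMeasure n ξ) := by
    obtain ⟨M, hM⟩ := hgc.exists_bound_of_continuous hg
    refine memLp_gaussMeasure_of_le hξ hg (M := M) fun z => (hM z).trans ?_
    exact le_mul_of_one_le_right ((norm_nonneg _).trans (hM z))
      (Real.one_le_exp (mul_nonneg (half_pos hξ).le (nsq_nonneg z)))
  have hdu (v : Fin n → ℂ) : MemLp (fun z => fderiv ℝ u z v) 2 (gaussMeasure n ξ) :=
    hmem ((hu.continuous_fderiv (by simp)).clm_apply continuous_const) (huc.fderiv_apply ℝ v)
  have hdbar (j : Fin n) : MemLp (dZbarC j u) 2 (gaussMeasure n ξ) :=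
    ((hdu _).add ((hdu _).const_mul Complex.I)).const_mul (1 / 2)
  have hu' : Differentiable ℝ u := hu.differentiable (by simp)
  let V (j : Fin n) : Lp ℂ 2 (gaussMeasure n ξ) := (hdbar j).toLp _
  have hV (j : Fin n) : ⇑(V j) =ᵐ[gaussMeasure n ξ] dZbarC j u := MemLp.coeFn_toLp (hdbar j)
  let K : Submodule ℂ (Lp ℂ 2 (gaussMeasure n ξ)) := (LinearMap.range (polyToLp hξ ∘ₗ
    (MvPolynomial.rename (Sum.inl : Fin n → Fin n ⊕ Fin n)).toLinearMap)).topologicalClosure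
  have : CompleteSpace K := Submodule.topologicalClosure.completeSpace _
  have hmain := norm_sub_starProjection_sq_le hξ (polyToLp hξ) (denseRange_polyToLp hξ)
    (fun j p q => inner_polyToLp_polyAdj hξ j (differentiable_polyEval q)
      (fun v => by simpa only [fderiv_polyEval] using memLp_polyEval hξ _) (coeFn_polyToLp hξ q)
      (by simpa only [dZbarC_polyEval] using coeFn_polyToLp hξ _) p)
    K rfl uL V (fun j p => inner_polyToLp_polyAdj hξ j hu' hdu huL (hV j) p)
  have hmin : ∀ g ∈ FockSet n ξ, ‖uL - B uL‖ ≤ ‖uL - g‖ := by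
    intro g hg
    have h0 : inner ℂ (uL - B uL) (B uL - g) = 0 := by
      rw [inner_sub_right, hBorth _ _ (hBmem uL), hBorth _ _ hg, sub_zero]
    have := norm_add_sq_eq_norm_sq_add_norm_sq_of_inner_eq_zero (𝕜 := ℂ) _ _ h0
    rw [sub_add_sub_cancel] at this
    nlinarith [norm_nonneg (uL - g), norm_nonneg (uL - B uL), norm_nonneg (B uL - g)]
  have hminK : ‖uL - B uL‖ ≤ ‖uL - K.starProjection uL‖ := by
    refine closure_minimal (t := {g | ‖uL - B uL‖ ≤ ‖uL - g‖}) ?_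
      (isClosed_le continuous_const (by fun_prop)) (K.starProjection_apply_mem uL)
    rintro _ ⟨q, rfl⟩
    exact hmin _ ⟨_, differentiable_polyEval_rename_inl q, coeFn_polyToLp hξ _⟩
  have hR : ∫ z, (∑ j, ‖dZbarC j u z‖ ^ 2) ∂(gaussMeasure n ξ) = ∑ j, ‖V j‖ ^ 2 := by
    rw [integral_finsetSum _ fun j _ =>
      (memLp_two_iff_integrable_sq_norm (hdbar j).1).1 (hdbar j)]
    refine Finset.sum_congr rfl fun j _ => ?_
    rw [Lp_norm_sq_eq_integral]
    refine integral_congr_ae ?_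
    filter_upwards [hV j] with z hz
    rw [hz]
  rw [← Lp_norm_sq_eq_integral, hR]
  calc ‖uL - B uL‖ ^ 2 ≤ ‖uL - K.starProjection uL‖ ^ 2 :=
        pow_le_pow_left₀ (norm_nonneg _) hminK 2
    _ ≤ 1 / (2 * ξ) * ∑ j, ‖V j‖ ^ 2 := hmain
    _ ≤ 2 / ξ * ∑ j, ‖V j‖ ^ 2 := by
      refine mul_le_mul_of_nonneg_right ?_ (Finset.sum_nonneg fun j _ => sq_nonneg _)
      rw [div_le_div_iff₀ (by positivity) hξ]
      linarith
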